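/- Assume: (A1') there exists σ > 0 such that lim_{n→∞} ℙ^0(X_n/√n ≤ x) = ∫_{−∞}^x φ_{σ²}(ξ) dξ for all x ∈ ℝ; (A2) there exists μ > 0 such that lim_{T→∞} (1/(y−x)) ∫_x^y (1/ω_{⌊Tξ⌋}) dξ = μ for every pair of real numbers x < y; (A3') sup_{n≥0} sup_{k∈ℤ} √n · (P^n)_{0,k} < ∞. Define g_n(x) = (1/2){ ℙ^0(X_n = ⌊√n·x⌋) + ℙ^0(X_{n+1} = ⌊√n·x⌋) }. Then for every compact set I ⊂ ℝ, lim_{n→∞} sup_{x∈I} | ω_{⌊√n·x⌋} · √n · g_n(x) − (1/μ)·φ_{σ²}(x) | = 0. -/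

import Mathlib

open Filter MeasureTheory Topology

/-- `(P^n)_{k,j}` for the balanced walk on `ℤ` with transition probabilities
`P_{k,k-1} = P_{k,k+1} = ω k`, `P_{k,k} = 1 - 2 ω k`. -/
noncomputable def Ppow (ω : ℤ → ℝ) : ℕ → ℤ → ℤ → ℝ
  | 0, k, j => if k = j then 1 else 0
  | n + 1, k, j =>
      ω k * Ppow ω n (k - 1) j + (1 - 2 * ω k) * Ppow ω n k j + ω k * Ppow ω n (k + 1) j

/-- The centered Gaussian density with variance `σ²`. -/
noncomputable def gauss (σ : ℝ) (x : ℝ) : ℝ :=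
  (1 / (Real.sqrt (2 * Real.pi) * σ)) * Real.exp (-x ^ 2 / (2 * σ ^ 2))


/-! ### Algebra of the transition matrix -/

section TransitionMatrix

variable {ω : ℤ → ℝ}

lemma Ppow_nonneg (hω : ∀ k, 0 < ω k ∧ ω k ≤ 1 / 2) (n : ℕ) (k j : ℤ) : 0 ≤ Ppow ω n k j := by
  induction n generalizing k with
  | zero => rw [Ppow]; split_ifs <;> norm_num
  | succ n ih =>
    rw [Ppow]
    have h1 := (hω k).1.le
    have h2 : 0 ≤ 1 - 2 * ω k := by linarith [(hω k).2]
    have := ih (k - 1)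
    have := ih k
    have := ih (k + 1)
    positivity

lemma Ppow_eq_zero (ω : ℤ → ℝ) (n : ℕ) (k j : ℤ) (h : (n : ℤ) < |k - j|) : Ppow ω n k j = 0 := by
  induction n generalizing k with
  | zero =>
    rw [Ppow, if_neg]
    rintro rfl
    simp at h
  | succ n ih =>
    push_cast at h
    rw [Ppow, ih (k - 1) (by grind), ih k (by grind), ih (k + 1) (by grind)]
    ring

lemma Ppow_forward (ω : ℤ → ℝ) (n : ℕ) (k j : ℤ) :
    Ppow ω (n + 1) k j = ω (j - 1) * Ppow ω n k (j - 1) + (1 - 2 * ω j) * Ppow ω n k j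
      + ω (j + 1) * Ppow ω n k (j + 1) := by
  induction n generalizing k with
  | zero =>
    simp only [Ppow]
    by_cases h1 : k = j
    · subst h1
      have h4 : k ≠ k - 1 := by omega
      simp [h4]
    · by_cases h2 : k = j - 1
      · subst h2
        have h4 : j - 1 - 1 ≠ j := by omega
        have h5 : j - 1 ≠ j + 1 := by omega
        simp [h4, h5]
      · by_cases h3 : k = j + 1
        · subst h3
          have h4 : j + 1 + 1 ≠ j := by omega
          simp [h2, h4]
        · have h4 : k - 1 ≠ j := by omega
          have h5 : k + 1 ≠ j := by omega
          simp [h1, h2, h3, h4, h5]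
  | succ n ih =>
    rw [Ppow.eq_2 ω k j (n + 1), ih (k - 1), ih (k + 1), Ppow.eq_2 ω k (j - 1) n,
      Ppow.eq_2 ω k (j + 1) n]
    linear_combination (1 - 2 * ω k) * ih k - (1 - 2 * ω j) * Ppow.eq_2 ω k j n

lemma Ppow_reversible (ω : ℤ → ℝ) (n : ℕ) (k j : ℤ) :
    ω k * Ppow ω n j k = ω j * Ppow ω n k j := by
  induction n generalizing j with
  | zero =>
    simp only [Ppow]
    by_cases h : k = j
    · subst h; rfl
    · simp [h, Ne.symm h]
  | succ n ih =>
    rw [Ppow_forward ω n k j, Ppow]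
    linear_combination ω j * ih (j - 1) + (1 - 2 * ω j) * ih j + ω j * ih (j + 1)

lemma HasSum.of_eq {f g : ℤ → ℝ} {a b : ℝ} (h : HasSum f a) (hfg : ∀ k, g k = f k)
    (hab : b = a) : HasSum g b := by
  rw [hab, funext hfg]
  exact h

lemma hasSum_Ppow_mul_Ppow (ω : ℤ → ℝ) (m n : ℕ) (i j : ℤ) :
    HasSum (fun k => Ppow ω m i k * Ppow ω n k j) (Ppow ω (m + n) i j) := by
  induction m generalizing i with
  | zero =>
    refine (hasSum_single (f := fun k => Ppow ω 0 i k * Ppow ω n k j) i fun k hk => ?_).of_eq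
      (fun _ => rfl) ?_
    · simp [Ppow, hk.symm]
    · simp [Ppow]
  | succ m ih =>
    have h := (((ih (i - 1)).mul_left (ω i)).add ((ih i).mul_left (1 - 2 * ω i))).add
      ((ih (i + 1)).mul_left (ω i))
    rw [Nat.add_right_comm, Ppow]
    refine h.of_eq (fun k => ?_) rfl
    rw [Ppow]
    ring

lemma hasSum_Ppow_mul_Ppow_div (hω : ∀ k, 0 < ω k ∧ ω k ≤ 1 / 2) (m n : ℕ) :
    HasSum (fun k => Ppow ω m k 0 * Ppow ω n k 0 / ω k) (Ppow ω (m + n) 0 0 / ω 0) := by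
  refine ((hasSum_Ppow_mul_Ppow ω m n 0 0).div_const (ω 0)).of_eq (fun k => ?_) rfl
  have := Ppow_reversible ω m k 0
  have h1 := (hω k).1.ne'
  have h2 := (hω 0).1.ne'
  field_simp
  linear_combination (-Ppow ω n k 0) * this

lemma hasSum_sub_shift {B : ℤ → ℝ} (hB : B.support.Finite) :
    HasSum (fun k => B (k + 1) - B k) 0 := by
  have h := (summable_of_hasFiniteSupport (L := .unconditional ℤ) hB).hasSum
  have h' := (Equiv.addRight (1 : ℤ)).hasSum_iff.mpr h
  simpa using h'.sub h

lemma Ppow_support_finite (ω : ℤ → ℝ) (n : ℕ) (j : ℤ) :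
    (Function.support fun k => Ppow ω n k j).Finite := by
  refine (Set.finite_Icc (j - n) (j + n)).subset fun k hk => ?_
  by_contra h
  refine hk (Ppow_eq_zero ω n k j ?_)
  simp only [Set.mem_Icc] at h
  grind

lemma Ppow_support_finite_right (ω : ℤ → ℝ) (n : ℕ) (j : ℤ) :
    (Function.support fun k => Ppow ω n j k).Finite := by
  refine (Set.finite_Icc (j - n) (j + n)).subset fun k hk => ?_
  by_contra h
  refine hk (Ppow_eq_zero ω n j k ?_)
  simp only [Set.mem_Icc] at h
  grind

/-- Dirichlet form of a time-averaged heat kernel. -/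
lemma hasSum_sq_averaged_increment (hω : ∀ k, 0 < ω k ∧ ω k ≤ 1 / 2) (n : ℕ) :
    HasSum (fun k => ((Ppow ω n (k + 1) 0 + Ppow ω (n + 1) (k + 1) 0)
        - (Ppow ω n k 0 + Ppow ω (n + 1) k 0)) ^ 2)
      ((Ppow ω (2 * n) 0 0 + Ppow ω (2 * n + 1) 0 0 - Ppow ω (2 * n + 2) 0 0
        - Ppow ω (2 * n + 3) 0 0) / ω 0) := by
  set H : ℤ → ℝ := fun k => Ppow ω n k 0 + Ppow ω (n + 1) k 0 with hH
  have hHfin : H.support.Finite :=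
    ((Ppow_support_finite ω n 0).union (Ppow_support_finite ω (n + 1) 0)).subset
      (Function.support_add _ _)
  have hB : (fun k => H k ^ 2 - H (k - 1) * H k).support.Finite := by
    refine hHfin.subset fun k hk h0 => hk ?_
    simp [h0]
  have h := ((((hasSum_Ppow_mul_Ppow_div hω n n).add (hasSum_Ppow_mul_Ppow_div hω n (n + 1))).sub
    (hasSum_Ppow_mul_Ppow_div hω n (n + 2))).sub
    (hasSum_Ppow_mul_Ppow_div hω (n + 1) (n + 2))).add (hasSum_sub_shift hB)
  have e1 : n + n = 2 * n := by ring
  have e2 : n + (n + 1) = 2 * n + 1 := by ring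
  have e3 : n + (n + 2) = 2 * n + 2 := by ring
  have e4 : n + 1 + (n + 2) = 2 * n + 3 := by ring
  rw [e1, e2, e3, e4] at h
  refine h.of_eq (fun k => ?_) ?_
  · have hk := (hω k).1.ne'
    have r1 : Ppow ω (n + 1) k 0 = _ := Ppow.eq_2 ω k 0 n
    have r2 : Ppow ω (n + 2) k 0 = _ := Ppow.eq_2 ω k 0 (n + 1)
    simp only [hH, add_sub_cancel_right]
    rw [r2]
    field_simp
    linear_combination (Ppow ω n k 0 + Ppow ω (n + 1) k 0) * r1
  · ring

lemma Ppow_even_sub_antitone (hω : ∀ k, 0 < ω k ∧ ω k ≤ 1 / 2) :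
    Antitone fun n : ℕ => Ppow ω (2 * n) 0 0 - Ppow ω (2 * n + 2) 0 0 := by
  refine antitone_nat_of_succ_le fun n => ?_
  have h := ((hasSum_Ppow_mul_Ppow_div hω n n).sub
    ((hasSum_Ppow_mul_Ppow_div hω n (n + 2)).mul_left 2)).add
    (hasSum_Ppow_mul_Ppow_div hω (n + 2) (n + 2))
  have h0 := h.nonneg fun k => by
    have : 0 ≤ (Ppow ω n k 0 - Ppow ω (n + 2) k 0) ^ 2 / ω k :=
      div_nonneg (sq_nonneg _) (hω k).1.le
    refine this.trans (le_of_eq ?_)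
    ring
  have e1 : n + n = 2 * n := by ring
  have e3 : n + (n + 2) = 2 * n + 2 := by ring
  have e4 : n + 2 + (n + 2) = 2 * n + 4 := by ring
  rw [e1, e3, e4] at h0
  have h2 : 0 ≤ (Ppow ω (2 * n) 0 0 - 2 * Ppow ω (2 * n + 2) 0 0 + Ppow ω (2 * n + 4) 0 0) / ω 0 :=
    h0.trans (le_of_eq (by ring))
  rw [le_div_iff₀ (hω 0).1] at h2
  have e5 : 2 * (n + 1) = 2 * n + 2 := by ring
  simp only [e5, Nat.add_assoc, Nat.reduceAdd]
  linarith

/-- Nonnegativity of `I + P`, tested against `(I - P) Pⁿ δ₀`. -/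
lemma Ppow_odd_sub_le (hω : ∀ k, 0 < ω k ∧ ω k ≤ 1 / 2) (n : ℕ) :
    Ppow ω (2 * n + 1) 0 0 - Ppow ω (2 * n + 3) 0 0
      ≤ Ppow ω (2 * n) 0 0 - Ppow ω (2 * n + 2) 0 0 := by
  set v : ℤ → ℝ := fun k => Ppow ω n k 0 - Ppow ω (n + 1) k 0 with hv
  have hvfin : v.support.Finite :=
    ((Ppow_support_finite ω n 0).union (Ppow_support_finite ω (n + 1) 0)).subset
      (Function.support_sub _ _)
  have hB : (fun k => v k ^ 2 + v (k - 1) * v k).support.Finite := by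
    refine hvfin.subset fun k hk h0 => hk ?_
    simp [h0]
  have h := ((((hasSum_Ppow_mul_Ppow_div hω n n).sub (hasSum_Ppow_mul_Ppow_div hω n (n + 1))).sub
    (hasSum_Ppow_mul_Ppow_div hω n (n + 2))).add
    (hasSum_Ppow_mul_Ppow_div hω (n + 1) (n + 2))).add (hasSum_sub_shift hB)
  have e1 : n + n = 2 * n := by ring
  have e2 : n + (n + 1) = 2 * n + 1 := by ring
  have e3 : n + (n + 2) = 2 * n + 2 := by ring
  have e4 : n + 1 + (n + 2) = 2 * n + 3 := by ring
  rw [e1, e2, e3, e4] at h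
  have h0 := h.nonneg fun k => by
    have hk := (hω k).1.ne'
    have h3 : 0 ≤ (2 / ω k - 4) := by
      rw [sub_nonneg, le_div_iff₀ (hω k).1]
      linarith [(hω k).2]
    have : 0 ≤ (v (k + 1) + v k) ^ 2 + (2 / ω k - 4) * v k ^ 2 := by positivity
    refine this.trans (le_of_eq ?_)
    have r1 : Ppow ω (n + 1) k 0 = _ := Ppow.eq_2 ω k 0 n
    have r2 : Ppow ω (n + 2) k 0 = _ := Ppow.eq_2 ω k 0 (n + 1)
    simp only [hv, add_sub_cancel_right]
    rw [r2]
    field_simp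
    linear_combination (Ppow ω (n + 1) k 0 - Ppow ω n k 0) * r1
  have h2 : 0 ≤ (Ppow ω (2 * n) 0 0 - Ppow ω (2 * n + 1) 0 0 - Ppow ω (2 * n + 2) 0 0
      + Ppow ω (2 * n + 3) 0 0) / ω 0 := h0.trans (le_of_eq (by ring))
  rw [le_div_iff₀ (hω 0).1] at h2
  linarith

/-- The time-averaged heat kernel, relative to the reversible measure `1 / ω`. -/
noncomputable def avgKernel (ω : ℤ → ℝ) (n : ℕ) (k : ℤ) : ℝ :=
  ω k * ((1 / 2) * (Ppow ω n 0 k + Ppow ω (n + 1) 0 k))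

lemma avgKernel_eq (ω : ℤ → ℝ) (n : ℕ) (k : ℤ) :
    avgKernel ω n k = ω 0 / 2 * (Ppow ω n k 0 + Ppow ω (n + 1) k 0) := by
  rw [avgKernel]
  linear_combination (1 / 2) * Ppow_reversible ω n k 0
    + (1 / 2) * Ppow_reversible ω (n + 1) k 0

lemma avgKernel_sub_sq_le_nat (hω : ∀ k, 0 < ω k ∧ ω k ≤ 1 / 2) (n : ℕ) (k : ℤ) (m : ℕ) :
    (avgKernel ω n (k + m) - avgKernel ω n k) ^ 2
      ≤ m * (Ppow ω (2 * n) 0 0 - Ppow ω (2 * n + 2) 0 0) := by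
  set D : ℤ → ℝ := fun k => avgKernel ω n (k + 1) - avgKernel ω n k with hD
  have hsum : HasSum (fun k => D k ^ 2) (ω 0 / 4 * (Ppow ω (2 * n) 0 0 + Ppow ω (2 * n + 1) 0 0
      - Ppow ω (2 * n + 2) 0 0 - Ppow ω (2 * n + 3) 0 0)) := by
    refine ((hasSum_sq_averaged_increment hω n).mul_left (ω 0 ^ 2 / 4)).of_eq (fun k => ?_) ?_
    · simp only [hD, avgKernel_eq]
      ring
    · have := (hω 0).1.ne'
      field_simp
  have htel : avgKernel ω n (k + m) - avgKernel ω n k = ∑ i ∈ Finset.range m, D (k + i) := by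
    have := Finset.sum_range_sub (fun i : ℕ => avgKernel ω n (k + i)) m
    simp only [Nat.cast_zero, add_zero] at this
    rw [← this]
    refine Finset.sum_congr rfl fun i _ => ?_
    simp [hD, add_assoc]
  have hle : ∑ i ∈ Finset.range m, D (k + i) ^ 2 ≤ ω 0 / 4 * (Ppow ω (2 * n) 0 0
      + Ppow ω (2 * n + 1) 0 0 - Ppow ω (2 * n + 2) 0 0 - Ppow ω (2 * n + 3) 0 0) := by
    have := sum_le_hasSum ((Finset.range m).map
      ⟨fun i : ℕ => k + (i : ℤ), fun a b h => by simpa using h⟩) (fun i _ => sq_nonneg (D i)) hsum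
    rw [Finset.sum_map] at this
    exact this
  have hcs := sq_sum_le_card_mul_sum_sq (s := Finset.range m) (f := fun i : ℕ => D (k + i))
  rw [Finset.card_range] at hcs
  rw [htel]
  refine hcs.trans (mul_le_mul_of_nonneg_left (hle.trans ?_) (Nat.cast_nonneg m))
  have h1 := Ppow_odd_sub_le hω n
  have h2 : 0 ≤ ω 0 / 4 * (Ppow ω (2 * n) 0 0 + Ppow ω (2 * n + 1) 0 0
      - Ppow ω (2 * n + 2) 0 0 - Ppow ω (2 * n + 3) 0 0) := hsum.nonneg fun k => sq_nonneg _
  have h3 := hω 0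
  rw [mul_nonneg_iff_of_pos_left (by linarith)] at h2
  nlinarith

lemma avgKernel_sub_sq_le (hω : ∀ k, 0 < ω k ∧ ω k ≤ 1 / 2) (n : ℕ) (k l : ℤ) :
    (avgKernel ω n k - avgKernel ω n l) ^ 2
      ≤ |(k : ℝ) - l| * (Ppow ω (2 * n) 0 0 - Ppow ω (2 * n + 2) 0 0) := by
  wlog h : l ≤ k generalizing k l
  · rw [abs_sub_comm, sub_sq_comm]
    exact this l k (by omega)
  obtain ⟨m, rfl⟩ := Int.le.dest h
  convert avgKernel_sub_sq_le_nat hω n l m using 2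
  push_cast
  simp

lemma exists_Ppow_even_sub_le (hω : ∀ k, 0 < ω k ∧ ω k ≤ 1 / 2)
    (hA3 : ∃ M : ℝ, ∀ n : ℕ, ∀ k : ℤ, Real.sqrt n * Ppow ω n 0 k ≤ M) :
    ∃ C : ℝ, 0 < C ∧ ∀ n : ℕ,
      n * (Real.sqrt n * (Ppow ω (2 * n) 0 0 - Ppow ω (2 * n + 2) 0 0)) ≤ C := by
  obtain ⟨M, hM⟩ := hA3
  have hM0 : 0 ≤ M := by simpa using hM 0 0
  have hanti := Ppow_even_sub_antitone hω
  set c : ℕ → ℝ := fun n => Ppow ω (2 * n) 0 0 with hc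
  set d : ℕ → ℝ := fun n => Ppow ω (2 * n) 0 0 - Ppow ω (2 * n + 2) 0 0 with hd
  have key : ∀ m j : ℕ, j * d (m + j) ≤ c m := by
    intro m j
    have h1 : ∑ i ∈ Finset.range j, d (m + j) ≤ ∑ i ∈ Finset.range j, d (m + i) :=
      Finset.sum_le_sum fun i hi => hanti (by simp at hi; omega)
    have h2 : ∑ i ∈ Finset.range j, d (m + i) = c m - c (m + j) :=
      Finset.sum_range_sub' (fun i => c (m + i)) j
    have h3 : 0 ≤ c (m + j) := Ppow_nonneg hω _ _ _
    simp only [Finset.sum_const, Finset.card_range, nsmul_eq_mul] at h1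
    linarith
  refine ⟨4 * M + 1, by linarith, fun n => ?_⟩
  change n * (Real.sqrt n * d n) ≤ 4 * M + 1
  have hs := Real.sqrt_nonneg n
  rcases le_total (d n) 0 with hneg | hpos
  · have : n * (Real.sqrt n * d n) ≤ 0 :=
      mul_nonpos_of_nonneg_of_nonpos (Nat.cast_nonneg n) (mul_nonpos_of_nonneg_of_nonpos hs hneg)
    linarith
  rcases Nat.lt_or_ge n 2 with hn | hn
  · interval_cases n
    · simp; linarith
    · have := key 0 1
      simp [hc, Ppow] at this
      simp
      linarith
  · set m := n / 2 with hm
    have hkey := key m (n - m)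
    have e : m + (n - m) = n := by omega
    rw [e] at hkey
    have h1 : (n : ℝ) ≤ 2 * ((n - m : ℕ) : ℝ) := by exact_mod_cast (by omega)
    have h2 : Real.sqrt n ≤ 2 * Real.sqrt ((2 * m : ℕ) : ℝ) := by
      rw [Real.sqrt_le_left (by positivity), mul_pow, Real.sq_sqrt (by positivity)]
      norm_num
      exact_mod_cast (by omega : n ≤ 4 * (2 * m))
    have h3 := hM (2 * m) 0
    have h4 : n * d n ≤ 2 * c m := by nlinarith
    have h5 : 0 ≤ c m := Ppow_nonneg hω _ _ _
    calc n * (Real.sqrt n * d n) = Real.sqrt n * (n * d n) := by ring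
      _ ≤ (2 * Real.sqrt ((2 * m : ℕ) : ℝ)) * (2 * c m) := by gcongr
      _ = 4 * (Real.sqrt ((2 * m : ℕ) : ℝ) * c m) := by ring
      _ ≤ 4 * M + 1 := by linarith

end TransitionMatrix

/-! ### Integrals of step functions -/

section StepFunctions

lemma intervalIntegrable_floor (q : ℤ → ℝ) {T : ℝ} (hT : 0 ≤ T) (a b : ℝ) :
    IntervalIntegrable (fun s => q ⌊T * s⌋) volume a b := by
  rw [intervalIntegrable_iff]
  have hmeas : Measurable fun s : ℝ => q ⌊T * s⌋ :=
    (measurable_from_top (f := q)).comp (Int.measurable_floor.comp (measurable_id.const_mul T))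
  refine Measure.integrableOn_of_bounded (s_finite := by simp)
    (M := ∑ k ∈ Finset.Icc ⌊T * min a b⌋ ⌊T * max a b⌋, |q k|) hmeas.aestronglyMeasurable ?_
  refine (ae_restrict_iff' measurableSet_uIoc).mpr (Eventually.of_forall fun s hs => ?_)
  rw [Set.uIoc, Set.mem_Ioc] at hs
  rw [Real.norm_eq_abs]
  refine Finset.single_le_sum (f := fun k => |q k|) (fun k _ => abs_nonneg _) ?_
  rw [Finset.mem_Icc]
  exact ⟨Int.floor_le_floor (by gcongr; exact hs.1.le),
    Int.floor_le_floor (by gcongr; exact hs.2)⟩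

lemma integral_floor_unit (q : ℤ → ℝ) (k : ℤ) :
    ∫ s in (k : ℝ)..((k + 1 : ℤ) : ℝ), q ⌊s⌋ = q k := by
  have h : ∫ s in (k : ℝ)..((k + 1 : ℤ) : ℝ), q ⌊s⌋ = ∫ _ in (k : ℝ)..((k + 1 : ℤ) : ℝ), q k := by
    refine intervalIntegral.integral_congr_Ioo_of_le (by push_cast; linarith) fun s hs => ?_
    have : ⌊s⌋ = k := by
      rw [Int.floor_eq_iff]
      refine ⟨hs.1.le, ?_⟩
      have := hs.2
      push_cast at this
      exact this
    simp only [this]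
  rw [h]
  simp

lemma integral_floor_eq_sum (q : ℤ → ℝ) {m n : ℤ} (h : m ≤ n) :
    ∫ s in ((m + 1 : ℤ) : ℝ)..((n + 1 : ℤ) : ℝ), q ⌊s⌋ = ∑ k ∈ Finset.Ioc m n, q k := by
  induction n, h using Int.leInduction with
  | base => simp
  | succ n hmn ih =>
    have hi : ∀ a b : ℝ, IntervalIntegrable (fun s => q ⌊s⌋) volume a b := fun a b => by
      simpa using intervalIntegrable_floor q zero_le_one a b
    rw [← intervalIntegral.integral_add_adjacent_intervals (hi _ ((n + 1 : ℤ) : ℝ)) (hi _ _), ih,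
      integral_floor_unit, ← Finset.insert_Ioc_right_eq_Ioc_add_one hmn,
      Finset.sum_insert (by simp), add_comm]

lemma abs_integral_floor_sub_sum_le (q : ℤ → ℝ) {K : ℝ} (hq : ∀ k, |q k| ≤ K) {A B : ℝ}
    (hAB : A ≤ B) :
    |(∫ s in A..B, q ⌊s⌋) - ∑ k ∈ Finset.Ioc ⌊A⌋ ⌊B⌋, q k| ≤ 2 * K := by
  have hi : ∀ a b : ℝ, IntervalIntegrable (fun s => q ⌊s⌋) volume a b := fun a b => by
    simpa using intervalIntegrable_floor q zero_le_one a b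
  have hK : 0 ≤ K := (abs_nonneg _).trans (hq 0)
  have hb : ∀ t : ℝ, |∫ s in t..((⌊t⌋ + 1 : ℤ) : ℝ), q ⌊s⌋| ≤ K := by
    intro t
    have h := intervalIntegral.norm_integral_le_of_norm_le_const (a := t)
      (b := ((⌊t⌋ + 1 : ℤ) : ℝ)) (f := fun s => q ⌊s⌋) (C := K) fun s _ => hq _
    have h1 := Int.floor_le t
    have h2 := Int.lt_floor_add_one t
    refine h.trans (mul_le_of_le_one_right hK ?_)
    rw [abs_le]
    push_cast
    constructor <;> linarith
  have e := intervalIntegral.integral_add_adjacent_intervals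
    (hi A ((⌊A⌋ + 1 : ℤ) : ℝ)) (hi _ ((⌊B⌋ + 1 : ℤ) : ℝ))
  have e' := intervalIntegral.integral_add_adjacent_intervals (hi A B) (hi _ ((⌊B⌋ + 1 : ℤ) : ℝ))
  rw [integral_floor_eq_sum q (Int.floor_le_floor hAB)] at e
  have hA := abs_le.mp (hb A)
  have hB := abs_le.mp (hb B)
  rw [abs_le]
  constructor <;> linarith

lemma tsum_le_sub_tsum_le {p : ℤ → ℝ} (hp : p.support.Finite) {A B : ℝ} (hAB : A ≤ B) :
    (∑' k : ℤ, if (k : ℝ) ≤ B then p k else 0) - (∑' k : ℤ, if (k : ℝ) ≤ A then p k else 0)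
      = ∑ k ∈ Finset.Ioc ⌊A⌋ ⌊B⌋, p k := by
  have hs : ∀ t : ℝ, Summable fun k : ℤ => if (k : ℝ) ≤ t then p k else 0 := fun t => by
    refine summable_of_hasFiniteSupport (hp.subset fun k hk h0 => hk ?_)
    simp [h0]
  rw [← (hs B).tsum_sub (hs A), tsum_eq_sum (s := Finset.Ioc ⌊A⌋ ⌊B⌋)]
  · refine Finset.sum_congr rfl fun k hk => ?_
    rw [Finset.mem_Ioc, Int.floor_lt, Int.le_floor] at hk
    rw [if_pos hk.2, if_neg (not_le.mpr hk.1), sub_zero]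
  · intro k hk
    rw [Finset.mem_Ioc, Int.floor_lt, Int.le_floor, not_and_or, not_lt, not_le] at hk
    rcases hk with hk | hk
    · rw [if_pos hk, if_pos (hk.trans hAB), sub_self]
    · rw [if_neg (not_le.mpr hk), if_neg (not_le.mpr (hAB.trans_lt hk)), sub_self]

end StepFunctions

/-! ### Scaling limits -/

section Limits

variable {ω : ℤ → ℝ}

lemma sum_Ioc_Ppow_succ_sub (ω : ℤ → ℝ) (n : ℕ) {a b : ℤ} (h : a ≤ b) :
    ∑ k ∈ Finset.Ioc a b, (Ppow ω (n + 1) 0 k - Ppow ω n 0 k)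
      = (ω (b + 1) * Ppow ω n 0 (b + 1) - ω b * Ppow ω n 0 b)
        - (ω (a + 1) * Ppow ω n 0 (a + 1) - ω a * Ppow ω n 0 a) := by
  induction b, h using Int.leInduction with
  | base => simp
  | succ b hab ih =>
    rw [← Finset.insert_Ioc_right_eq_Ioc_add_one hab, Finset.sum_insert (by simp), ih,
      Ppow_forward, add_sub_cancel_right]
    ring

lemma Ppow_le_div_sqrt {M : ℝ} (hM : ∀ n : ℕ, ∀ k : ℤ, Real.sqrt n * Ppow ω n 0 k ≤ M)
    {n : ℕ} (hn : 0 < n) (k : ℤ) : Ppow ω n 0 k ≤ M / Real.sqrt n := by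
  rw [le_div_iff₀ (by positivity), mul_comm]
  exact hM n k

lemma Ppow_succ_le_div_sqrt (hω : ∀ k, 0 < ω k ∧ ω k ≤ 1 / 2) {M : ℝ}
    (hM : ∀ n : ℕ, ∀ k : ℤ, Real.sqrt n * Ppow ω n 0 k ≤ M)
    {n : ℕ} (hn : 0 < n) (k : ℤ) : Ppow ω (n + 1) 0 k ≤ M / Real.sqrt n := by
  rw [le_div_iff₀ (by positivity), mul_comm]
  refine le_trans ?_ (hM (n + 1) k)
  have := Ppow_nonneg hω (n + 1) 0 k
  gcongr
  simp

lemma integrable_gauss (σ : ℝ) (hσ : 0 < σ) : Integrable (gauss σ) := by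
  have h := (integrable_exp_neg_mul_sq (b := 1 / (2 * σ ^ 2)) (by positivity)).const_mul
    (1 / (Real.sqrt (2 * Real.pi) * σ))
  refine h.congr (Eventually.of_forall fun x => ?_)
  simp only [gauss]
  congr 2
  ring

lemma continuous_gauss (σ : ℝ) : Continuous (gauss σ) := by
  unfold gauss
  fun_prop

/-- The time-averaged kernel at time `n` on the diffusive scale. -/
noncomputable def scaledKernel (ω : ℤ → ℝ) (n : ℕ) (x : ℝ) : ℝ :=
  Real.sqrt n * avgKernel ω n ⌊Real.sqrt n * x⌋

lemma tendsto_integral_scaledKernel_div (hω : ∀ k, 0 < ω k ∧ ω k ≤ 1 / 2) {σ : ℝ} (hσ : 0 < σ)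
    (hA1 : ∀ x : ℝ,
      Tendsto (fun n : ℕ =>
          ∑' k : ℤ, if (k : ℝ) ≤ Real.sqrt n * x then Ppow ω n 0 k else 0)
        atTop (𝓝 (∫ ξ in Set.Iic x, gauss σ ξ)))
    (hA3 : ∃ M : ℝ, ∀ n : ℕ, ∀ k : ℤ, Real.sqrt n * Ppow ω n 0 k ≤ M)
    {a b : ℝ} (hab : a ≤ b) :
    Tendsto (fun n : ℕ => ∫ ξ in a..b, scaledKernel ω n ξ * (1 / ω ⌊Real.sqrt n * ξ⌋)) atTop
      (𝓝 (∫ ξ in a..b, gauss σ ξ)) := by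
  obtain ⟨M, hM⟩ := hA3
  have hlim := (hA1 b).sub (hA1 a)
  rw [intervalIntegral.integral_Iic_sub_Iic (integrable_gauss σ hσ).integrableOn
    (integrable_gauss σ hσ).integrableOn] at hlim
  have hsqrt : Tendsto (fun n : ℕ => Real.sqrt n) atTop atTop :=
    Real.tendsto_sqrt_atTop.comp tendsto_natCast_atTop_atTop
  have herr : Tendsto (fun n : ℕ => 3 * (M / Real.sqrt n)) atTop (𝓝 0) := by
    simpa using (hsqrt.const_div_atTop M).const_mul 3
  refine tendsto_of_tendsto_of_dist hlim (squeeze_zero' (Eventually.of_forall fun _ => dist_nonneg)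
    ?_ herr)
  filter_upwards [eventually_gt_atTop 0] with n hn
  have hs : 0 < Real.sqrt n := by positivity
  set K := M / Real.sqrt n with hK
  set q : ℤ → ℝ := fun k => (1 / 2) * (Ppow ω n 0 k + Ppow ω (n + 1) 0 k) with hq
  have hp0 : ∀ k, 0 ≤ Ppow ω n 0 k := Ppow_nonneg hω n 0
  have hp1 : ∀ k, Ppow ω n 0 k ≤ K := Ppow_le_div_sqrt hM hn
  have hqK : ∀ k, |q k| ≤ K := by
    intro k
    have h2 := Ppow_nonneg hω (n + 1) 0 k
    have h4 := Ppow_succ_le_div_sqrt hω hM hn k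
    rw [abs_le]
    constructor <;> simp only [hq] <;> linarith [hp0 k, hp1 k]
  have hint : ∫ ξ in a..b, scaledKernel ω n ξ * (1 / ω ⌊Real.sqrt n * ξ⌋)
      = ∫ s in (Real.sqrt n * a)..(Real.sqrt n * b), q ⌊s⌋ := by
    rw [← intervalIntegral.mul_integral_comp_mul_left, ← intervalIntegral.integral_const_mul]
    refine intervalIntegral.integral_congr fun ξ _ => ?_
    have := (hω ⌊Real.sqrt n * ξ⌋).1.ne'
    simp only [scaledKernel, avgKernel, hq]
    field_simp
  have hAB : Real.sqrt n * a ≤ Real.sqrt n * b := by gcongr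
  have h1 := abs_le.mp (abs_integral_floor_sub_sum_le q hqK hAB)
  have hfl := Int.floor_le_floor hAB
  have h2 := sum_Ioc_Ppow_succ_sub ω n hfl
  rw [Finset.sum_sub_distrib] at h2
  have h3 : ∑ k ∈ Finset.Ioc ⌊Real.sqrt n * a⌋ ⌊Real.sqrt n * b⌋, q k
      = (1 / 2) * (∑ k ∈ Finset.Ioc ⌊Real.sqrt n * a⌋ ⌊Real.sqrt n * b⌋, Ppow ω n 0 k
        + ∑ k ∈ Finset.Ioc ⌊Real.sqrt n * a⌋ ⌊Real.sqrt n * b⌋, Ppow ω (n + 1) 0 k) := by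
    rw [← Finset.sum_add_distrib, Finset.mul_sum]
  have hu : ∀ k, 0 ≤ ω k * Ppow ω n 0 k ∧ ω k * Ppow ω n 0 k ≤ K / 2 := by
    intro k
    refine ⟨mul_nonneg (hω k).1.le (hp0 k), ?_⟩
    have := mul_le_mul (hω k).2 (hp1 k) (hp0 k) (by norm_num)
    linarith
  have hu1 := hu ⌊Real.sqrt n * a⌋
  have hu2 := hu (⌊Real.sqrt n * a⌋ + 1)
  have hu3 := hu ⌊Real.sqrt n * b⌋
  have hu4 := hu (⌊Real.sqrt n * b⌋ + 1)
  rw [tsum_le_sub_tsum_le (Ppow_support_finite_right ω n 0) hAB, hint, Real.dist_eq, abs_le]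
  constructor <;> linarith

lemma scaledKernel_sub_sq_le (hω : ∀ k, 0 < ω k ∧ ω k ≤ 1 / 2)
    (hA3 : ∃ M : ℝ, ∀ n : ℕ, ∀ k : ℤ, Real.sqrt n * Ppow ω n 0 k ≤ M) :
    ∃ C : ℝ, 0 < C ∧ ∀ n : ℕ, 0 < n → ∀ x y : ℝ,
      (scaledKernel ω n x - scaledKernel ω n y) ^ 2 ≤ C * (|x - y| + 1 / Real.sqrt n) := by
  obtain ⟨C, hC, h⟩ := exists_Ppow_even_sub_le hω hA3
  refine ⟨C, hC, fun n hn x y => ?_⟩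
  have hs : 0 < Real.sqrt n := by positivity
  have hsq : Real.sqrt n * Real.sqrt n = n := Real.mul_self_sqrt (Nat.cast_nonneg n)
  set d := Ppow ω (2 * n) 0 0 - Ppow ω (2 * n + 2) 0 0 with hd
  have h1 := avgKernel_sub_sq_le hω n ⌊Real.sqrt n * x⌋ ⌊Real.sqrt n * y⌋
  rw [← hd] at h1
  have h2 : |(⌊Real.sqrt n * x⌋ : ℝ) - ⌊Real.sqrt n * y⌋|
      ≤ Real.sqrt n * (|x - y| + 1 / Real.sqrt n) := by
    have e : Real.sqrt n * (|x - y| + 1 / Real.sqrt n)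
        = |Real.sqrt n * x - Real.sqrt n * y| + 1 := by
      rw [← mul_sub, abs_mul, abs_of_pos hs]
      field_simp
    rw [e]
    have a1 := Int.floor_le (Real.sqrt n * x)
    have a2 := Int.lt_floor_add_one (Real.sqrt n * x)
    have a3 := Int.floor_le (Real.sqrt n * y)
    have a4 := Int.lt_floor_add_one (Real.sqrt n * y)
    have a5 := le_abs_self (Real.sqrt n * x - Real.sqrt n * y)
    have a6 := neg_abs_le (Real.sqrt n * x - Real.sqrt n * y)
    rw [abs_le]
    constructor <;> linarith
  have hd0 : 0 ≤ d := by
    have := avgKernel_sub_sq_le hω n 0 1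
    rw [← hd] at this
    simpa using (sq_nonneg _).trans this
  calc (scaledKernel ω n x - scaledKernel ω n y) ^ 2
      = n * (avgKernel ω n ⌊Real.sqrt n * x⌋ - avgKernel ω n ⌊Real.sqrt n * y⌋) ^ 2 := by
        simp only [scaledKernel]
        linear_combination
          (avgKernel ω n ⌊Real.sqrt n * x⌋ - avgKernel ω n ⌊Real.sqrt n * y⌋) ^ 2 * hsq
    _ ≤ n * (Real.sqrt n * (|x - y| + 1 / Real.sqrt n) * d) := by gcongr; exact h1.trans (by gcongr)
    _ = (n * (Real.sqrt n * d)) * (|x - y| + 1 / Real.sqrt n) := by ring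
    _ ≤ C * (|x - y| + 1 / Real.sqrt n) := by gcongr; exact h n

lemma exists_abs_scaledKernel_le (hω : ∀ k, 0 < ω k ∧ ω k ≤ 1 / 2)
    (hA3 : ∃ M : ℝ, ∀ n : ℕ, ∀ k : ℤ, Real.sqrt n * Ppow ω n 0 k ≤ M) :
    ∃ M : ℝ, 0 ≤ M ∧ ∀ n : ℕ, 0 < n → ∀ x : ℝ, |scaledKernel ω n x| ≤ M := by
  obtain ⟨M, hM⟩ := hA3
  have hM0 : 0 ≤ M := by simpa using hM 0 0
  refine ⟨M, hM0, fun n hn x => ?_⟩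
  have hs : 0 < Real.sqrt n := by positivity
  set k := ⌊Real.sqrt n * x⌋ with hk
  have h1 := Ppow_nonneg hω n 0 k
  have h2 := Ppow_nonneg hω (n + 1) 0 k
  have h3 := Ppow_le_div_sqrt hM hn k
  have h4 := Ppow_succ_le_div_sqrt hω hM hn k
  have h5 := (hω k).1
  rw [abs_of_nonneg (by unfold scaledKernel avgKernel; positivity)]
  have h6 : avgKernel ω n k ≤ 1 * (M / Real.sqrt n) := by
    unfold avgKernel
    refine mul_le_mul ?_ ?_ (by positivity) zero_le_one
    · linarith [(hω k).2]
    · linarith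
  calc scaledKernel ω n x = Real.sqrt n * avgKernel ω n k := rfl
    _ ≤ Real.sqrt n * (1 * (M / Real.sqrt n)) := by gcongr
    _ = M := by field_simp

lemma scaledKernel_equicontinuous (hω : ∀ k, 0 < ω k ∧ ω k ≤ 1 / 2)
    (hA3 : ∃ M : ℝ, ∀ n : ℕ, ∀ k : ℤ, Real.sqrt n * Ppow ω n 0 k ≤ M) {η : ℝ} (hη : 0 < η) :
    ∃ δ > 0, ∀ᶠ n : ℕ in atTop, ∀ x y : ℝ, |x - y| ≤ δ →
      |scaledKernel ω n x - scaledKernel ω n y| ≤ η := by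
  obtain ⟨C, hC, h⟩ := scaledKernel_sub_sq_le hω hA3
  have hδ : 0 < η ^ 2 / (2 * C) := by positivity
  refine ⟨η ^ 2 / (2 * C), hδ, ?_⟩
  have hlim : Tendsto (fun n : ℕ => 1 / Real.sqrt n) atTop (𝓝 0) :=
    (Real.tendsto_sqrt_atTop.comp tendsto_natCast_atTop_atTop).const_div_atTop 1
  filter_upwards [eventually_gt_atTop 0, hlim.eventually (gt_mem_nhds hδ)] with n hn hn' x y hxy
  refine abs_le_of_sq_le_sq ((h n hn x y).trans ?_) hη.le
  calc C * (|x - y| + 1 / Real.sqrt n) ≤ C * (η ^ 2 / (2 * C) + η ^ 2 / (2 * C)) := by gcongr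
    _ = η ^ 2 := by field_simp; ring

lemma tendsto_scaledKernel (hω : ∀ k, 0 < ω k ∧ ω k ≤ 1 / 2) {σ : ℝ} (hσ : 0 < σ)
    (hA1 : ∀ x : ℝ,
      Tendsto (fun n : ℕ =>
          ∑' k : ℤ, if (k : ℝ) ≤ Real.sqrt n * x then Ppow ω n 0 k else 0)
        atTop (𝓝 (∫ ξ in Set.Iic x, gauss σ ξ)))
    {μ : ℝ} (hμ : 0 < μ)
    (hA2 : ∀ x y : ℝ, x < y →
      Tendsto (fun T : ℝ => (1 / (y - x)) * ∫ ξ in x..y, 1 / ω ⌊T * ξ⌋)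
        atTop (𝓝 μ))
    (hA3 : ∃ M : ℝ, ∀ n : ℕ, ∀ k : ℤ, Real.sqrt n * Ppow ω n 0 k ≤ M) (x : ℝ) :
    Tendsto (fun n : ℕ => scaledKernel ω n x) atTop (𝓝 ((1 / μ) * gauss σ x)) := by
  suffices hmul : Tendsto (fun n : ℕ => μ * scaledKernel ω n x) atTop (𝓝 (gauss σ x)) by
    have := hmul.const_mul (1 / μ)
    refine this.congr fun n => ?_
    field_simp
  simp only [Metric.tendsto_nhds, Real.dist_eq]
  intro ε hε
  obtain ⟨M, hM0, hM⟩ := exists_abs_scaledKernel_le hω hA3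
  obtain ⟨δ₁, hδ₁, hequi⟩ := scaledKernel_equicontinuous hω hA3 (η := ε / (8 * μ)) (by positivity)
  obtain ⟨δ₂, hδ₂, hcont⟩ := Metric.continuousAt_iff.mp ((continuous_gauss σ).continuousAt
    (x := x)) (ε / 4) (by positivity)
  obtain ⟨δ, hδ, hδδ₁, hδδ₂⟩ : ∃ δ > 0, δ ≤ δ₁ ∧ δ < δ₂ :=
    ⟨min δ₁ (δ₂ / 2), by positivity, min_le_left _ _,
      (min_le_right _ _).trans_lt (by linarith)⟩
  have hsqrt : Tendsto (fun n : ℕ => Real.sqrt n) atTop atTop :=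
    Real.tendsto_sqrt_atTop.comp tendsto_natCast_atTop_atTop
  have hA := (hA2 x (x + δ) (by linarith)).comp hsqrt
  have hB := (tendsto_integral_scaledKernel_div hω hσ hA1 hA3
    (by linarith : x ≤ x + δ)).const_mul (1 / δ)
  simp only [add_sub_cancel_left, Function.comp_def] at hA
  have hmean : |(1 / δ) * (∫ ξ in x..x + δ, gauss σ ξ) - gauss σ x| ≤ ε / 4 := by
    have h1 : ∫ ξ in x..x + δ, (gauss σ ξ - gauss σ x)
        = (∫ ξ in x..x + δ, gauss σ ξ) - δ * gauss σ x := by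
      rw [intervalIntegral.integral_sub ((continuous_gauss σ).intervalIntegrable _ _) (by simp)]
      simp
    have h2 := intervalIntegral.norm_integral_le_of_norm_le_const (a := x) (b := x + δ)
      (f := fun ξ => gauss σ ξ - gauss σ x) (C := ε / 4) fun ξ hξ => by
        rw [Set.uIoc_of_le (by linarith)] at hξ
        refine (hcont ?_).le
        rw [Real.dist_eq, abs_lt]
        constructor <;> linarith [hξ.1, hξ.2]
    rw [h1, add_sub_cancel_left, abs_of_pos hδ, Real.norm_eq_abs] at h2
    have e : (1 / δ) * (∫ ξ in x..x + δ, gauss σ ξ) - gauss σ x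
        = (1 / δ) * ((∫ ξ in x..x + δ, gauss σ ξ) - δ * gauss σ x) := by field_simp
    rw [e, abs_mul, abs_of_pos (by positivity)]
    calc 1 / δ * _ ≤ 1 / δ * (ε / 4 * δ) := by gcongr
      _ = ε / 4 := by field_simp
  have hA' := Metric.tendsto_nhds.mp hA (min μ (ε / (8 * (M + 1)))) (by positivity)
  have hB' := Metric.tendsto_nhds.mp hB (ε / 8) (by positivity)
  filter_upwards [hequi, hA', hB', eventually_gt_atTop 0] with n hn hnA hnB hn0
  set S := scaledKernel ω n with hS
  set A := 1 / δ * ∫ ξ in x..x + δ, 1 / ω ⌊Real.sqrt n * ξ⌋ with hAdef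
  set B := 1 / δ * ∫ ξ in x..x + δ, S ξ * (1 / ω ⌊Real.sqrt n * ξ⌋) with hBdef
  rw [Real.dist_eq, lt_min_iff] at hnA
  rw [Real.dist_eq] at hnB
  have hs := Real.sqrt_nonneg n
  have hA2μ : A ≤ 2 * μ := by linarith [(abs_lt.mp hnA.1).2]
  have i1 : IntervalIntegrable (fun ξ => 1 / ω ⌊Real.sqrt n * ξ⌋) volume x (x + δ) :=
    intervalIntegrable_floor (fun k => 1 / ω k) hs _ _
  have i2 : IntervalIntegrable (fun ξ => S ξ * (1 / ω ⌊Real.sqrt n * ξ⌋)) volume x (x + δ) :=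
    intervalIntegrable_floor (fun k => Real.sqrt n * avgKernel ω n k * (1 / ω k)) hs _ _
  have hdiff : |B - S x * A| ≤ ε / 4 := by
    have e : B - S x * A
        = 1 / δ * ∫ ξ in x..x + δ, (S ξ - S x) * (1 / ω ⌊Real.sqrt n * ξ⌋) := by
      simp only [sub_mul]
      rw [intervalIntegral.integral_sub i2 (i1.const_mul _), intervalIntegral.integral_const_mul]
      ring
    have hle : |∫ ξ in x..x + δ, (S ξ - S x) * (1 / ω ⌊Real.sqrt n * ξ⌋)|
        ≤ ∫ ξ in x..x + δ, ε / (8 * μ) * (1 / ω ⌊Real.sqrt n * ξ⌋) := by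
      rw [← Real.norm_eq_abs]
      refine intervalIntegral.norm_integral_le_of_norm_le (by linarith)
        (Eventually.of_forall fun ξ hξ => ?_) (i1.const_mul _)
      have hpos : 0 < 1 / ω ⌊Real.sqrt n * ξ⌋ := one_div_pos.mpr (hω _).1
      rw [Real.norm_eq_abs, abs_mul, abs_of_pos hpos]
      gcongr
      refine hn ξ x ?_
      rw [abs_le]
      constructor <;> linarith [hξ.1, hξ.2]
    rw [intervalIntegral.integral_const_mul] at hle
    rw [e, abs_mul, abs_of_pos (by positivity : 0 < 1 / δ)]
    calc 1 / δ * |∫ ξ in x..x + δ, (S ξ - S x) * (1 / ω ⌊Real.sqrt n * ξ⌋)|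
        ≤ 1 / δ * (ε / (8 * μ) * ∫ ξ in x..x + δ, 1 / ω ⌊Real.sqrt n * ξ⌋) := by gcongr
      _ = ε / (8 * μ) * A := by rw [hAdef]; ring
      _ ≤ ε / (8 * μ) * (2 * μ) := by gcongr
      _ = ε / 4 := by field_simp; ring
  have hbound : |S x * A - S x * μ| ≤ ε / 8 := by
    rw [← mul_sub, abs_mul]
    calc |S x| * |A - μ| ≤ (M + 1) * (ε / (8 * (M + 1))) :=
          mul_le_mul ((hM n hn0 x).trans (by linarith)) hnA.2.le (abs_nonneg _) (by linarith)
      _ = ε / 8 := by field_simp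
  rw [abs_le] at hdiff hbound hmean
  rw [abs_lt] at hnB ⊢
  constructor <;> linarith [hdiff.1, hdiff.2, hbound.1, hbound.2, hmean.1, hmean.2, hnB.1, hnB.2]

end Limits

/-- **Theorem 2, first part (local limit theorem, discrete time, time-averaged form).**
Assume (A1') the CLT for `X_n/√n` with limit variance `σ²`, (A2) the averages
`(1/(y-x)) ∫_x^y dξ/ω_{⌊Tξ⌋}` converge to `μ > 0`, and (A3') the heat-kernel bound
`sup_{n ≥ 0} sup_k √n (P^n)_{0,k} < ∞`.  Then, for
`g_n(x) = (1/2){ℙ^0(X_n = ⌊√n x⌋) + ℙ^0(X_{n+1} = ⌊√n x⌋)}`,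
`ω_{⌊√n x⌋} · √n · g_n(x) → φ_{σ²}(x)/μ` uniformly on compact sets. -/
theorem local_limit_theorem_discrete_time_averaged
    (ω : ℤ → ℝ) (hω : ∀ k : ℤ, 0 < ω k ∧ ω k ≤ 1 / 2)
    (σ : ℝ) (hσ : 0 < σ)
    -- (A1'): central limit theorem for `X_n/√n`
    (hA1 : ∀ x : ℝ,
      Tendsto (fun n : ℕ =>
          ∑' k : ℤ, if (k : ℝ) ≤ Real.sqrt n * x then Ppow ω n 0 k else 0)
        atTop (𝓝 (∫ ξ in Set.Iic x, gauss σ ξ)))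
    (μ : ℝ) (hμ : 0 < μ)
    -- (A2): averaging of the environment
    (hA2 : ∀ x y : ℝ, x < y →
      Tendsto (fun T : ℝ => (1 / (y - x)) * ∫ ξ in x..y, 1 / ω ⌊T * ξ⌋)
        atTop (𝓝 μ))
    -- (A3'): heat-kernel bound
    (hA3 : ∃ M : ℝ, ∀ n : ℕ, ∀ k : ℤ, Real.sqrt n * Ppow ω n 0 k ≤ M)
    -- `g_n(x)`
    (g : ℕ → ℝ → ℝ)
    (hg : ∀ (n : ℕ) (x : ℝ), g n x =
      (1 / 2) * (Ppow ω n 0 ⌊Real.sqrt n * x⌋ + Ppow ω (n + 1) 0 ⌊Real.sqrt n * x⌋)) :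
    -- local limit theorem, uniformly on compact sets
    ∀ I : Set ℝ, IsCompact I → ∀ ε > 0, ∃ N : ℕ, ∀ n ≥ N, ∀ x ∈ I,
      |ω ⌊Real.sqrt n * x⌋ * Real.sqrt n * g n x - (1 / μ) * gauss σ x| < ε := by
  intro I hI ε hε
  have hloc : TendstoLocallyUniformlyOn (scaledKernel ω) (fun x => (1 / μ) * gauss σ x) atTop I := by
    rw [Metric.tendstoLocallyUniformlyOn_iff]
    intro ε hε x _
    obtain ⟨δ₁, hδ₁, hequi⟩ := scaledKernel_equicontinuous hω hA3 (η := ε / 4) (by positivity)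
    have hcont : ContinuousAt (fun y => (1 / μ) * gauss σ y) x :=
      ((continuous_gauss σ).const_mul _).continuousAt
    obtain ⟨δ₂, hδ₂, hδ⟩ := Metric.continuousAt_iff.mp hcont (ε / 4) (by positivity)
    refine ⟨Metric.ball x (min δ₁ δ₂),
      mem_nhdsWithin_of_mem_nhds (Metric.ball_mem_nhds x (by positivity)), ?_⟩
    filter_upwards [hequi, Metric.tendsto_nhds.mp
      (tendsto_scaledKernel hω hσ hA1 hμ hA2 hA3 x) (ε / 4) (by positivity)] with n hn hn' y hy
    rw [Metric.mem_ball, lt_min_iff] at hy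
    have h1 := abs_le.mp (hn y x hy.1.le)
    have h2 := hδ hy.2
    rw [Real.dist_eq, abs_lt] at h2 hn' ⊢
    constructor <;> linarith [h1.1, h1.2, h2.1, h2.2, hn'.1, hn'.2]
  have hunif := Metric.tendstoUniformlyOn_iff.mp
    ((tendstoLocallyUniformlyOn_iff_tendstoUniformlyOn_of_compact hI).mp hloc) ε hε
  obtain ⟨N, hN⟩ := eventually_atTop.mp hunif
  refine ⟨N, fun n hn x hx => ?_⟩
  have h := hN n hn x hx
  rw [dist_comm, Real.dist_eq] at h
  convert h using 3
  rw [hg, scaledKernel, avgKernel]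
  ring
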